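/- Let n ≥ 5 and let N be a perfect group of order n! whose center Z(N) has exactly two elements and with N/Z(N) isomorphic to Aₙ. Suppose f : Sₙ → Aut(N) is an injective group homomorphism and g : Sₙ → N is a bijective map satisfying g(στ) = g(σ) · f(σ)(g(τ)) for all σ, τ ∈ Sₙ, such that f(Aₙ) ⊆ Inn(N), and let f̃ : Aₙ → N be an injective map with f(σ)(η) = f̃(σ) · η · f̃(σ)⁻¹ for all σ ∈ Aₙ and η ∈ N. Then the map ḡ : Aₙ → N/Z(N) given by ḡ(σ) = g(σ) f̃(σ) Z(N) is a group isomorphism. -/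

import Mathlib

theorem stmt_10 (n : ℕ) (hn : 5 ≤ n) (N : Type*) [Group N]
    (hcard : Nat.card N = n.factorial) (hperf : commutator N = ⊤)
    (hZ : Nat.card (Subgroup.center N) = 2)
    (hquot : Nonempty ((N ⧸ Subgroup.center N) ≃* alternatingGroup (Fin n)))
    (f : Equiv.Perm (Fin n) →* MulAut N) (hf : Function.Injective f)
    (g : Equiv.Perm (Fin n) → N) (hg : Function.Bijective g)
    (hfg : ∀ σ τ : Equiv.Perm (Fin n), g (σ * τ) = g σ * f σ (g τ))
    (hinn : ∀ σ ∈ alternatingGroup (Fin n), f σ ∈ (MulAut.conj (G := N)).range)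
    (ft : alternatingGroup (Fin n) → N) (hft : Function.Injective ft)
    (hftconj : ∀ (σ : alternatingGroup (Fin n)) (η : N),
      f (σ : Equiv.Perm (Fin n)) η = ft σ * η * (ft σ)⁻¹) :
    Function.Bijective (fun σ : alternatingGroup (Fin n) =>
        (↑(g (σ : Equiv.Perm (Fin n)) * ft σ) : N ⧸ Subgroup.center N)) ∧
      ∀ σ τ : alternatingGroup (Fin n),
        (↑(g ((σ * τ : alternatingGroup (Fin n)) : Equiv.Perm (Fin n)) * ft (σ * τ)) :
            N ⧸ Subgroup.center N) =
          ↑(g (σ : Equiv.Perm (Fin n)) * ft σ) * ↑(g (τ : Equiv.Perm (Fin n)) * ft τ) := by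
  classical
  have hsimple : IsSimpleGroup (alternatingGroup (Fin n)) :=
    alternatingGroup.isSimpleGroup (by simpa using hn)
  have hnt : Nontrivial (Fin n) := Fin.nontrivial_iff_two_le.2 (by omega)
  have hcA : 2 * Nat.card (alternatingGroup (Fin n)) = n.factorial := by
    rw [two_mul_nat_card_alternatingGroup, Nat.card_perm, Nat.card_fin]
  -- multiplicativity of `ft` modulo the center
  have hftmul : ∀ σ τ : alternatingGroup (Fin n),
      (↑(ft (σ * τ)) : N ⧸ Subgroup.center N) = ↑(ft σ * ft τ) := by
    intro σ τ
    rw [QuotientGroup.eq, Subgroup.mem_center_iff]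
    intro x
    have h1 := hftconj (σ * τ) x
    rw [Subgroup.coe_mul, map_mul, MulAut.mul_apply, hftconj τ, hftconj σ] at h1
    have h2 : (ft (σ * τ))⁻¹ * (ft σ * (ft τ * x * (ft τ)⁻¹) * (ft σ)⁻¹) * (ft σ * ft τ)
        = (ft (σ * τ))⁻¹ * (ft (σ * τ) * x * (ft (σ * τ))⁻¹) * (ft σ * ft τ) := by rw [h1]
    have h3 : (ft (σ * τ))⁻¹ * (ft σ * (ft τ * x * (ft τ)⁻¹) * (ft σ)⁻¹) * (ft σ * ft τ)
        = (ft (σ * τ))⁻¹ * (ft σ * ft τ) * x := by group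
    have h4 : (ft (σ * τ))⁻¹ * (ft (σ * τ) * x * (ft (σ * τ))⁻¹) * (ft σ * ft τ)
        = x * ((ft (σ * τ))⁻¹ * (ft σ * ft τ)) := by group
    rw [← h4, ← h2, h3]
  have hgA : ∀ σ τ : alternatingGroup (Fin n),
      g ((σ * τ : alternatingGroup (Fin n)) : Equiv.Perm (Fin n)) =
        g σ * (ft σ * g τ * (ft σ)⁻¹) := by
    intro σ τ
    rw [Subgroup.coe_mul, hfg, hftconj]
  have hmul : ∀ σ τ : alternatingGroup (Fin n),
        (↑(g ((σ * τ : alternatingGroup (Fin n)) : Equiv.Perm (Fin n)) * ft (σ * τ)) :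
            N ⧸ Subgroup.center N) =
          ↑(g (σ : Equiv.Perm (Fin n)) * ft σ) * ↑(g (τ : Equiv.Perm (Fin n)) * ft τ) := by
    intro σ τ
    rw [QuotientGroup.mk_mul, hftmul, hgA]
    simp only [QuotientGroup.mk_mul, QuotientGroup.mk_inv]
    group
  refine ⟨?_, hmul⟩
  let φ : alternatingGroup (Fin n) →* N ⧸ Subgroup.center N :=
    MonoidHom.mk' (fun σ => (↑(g (σ : Equiv.Perm (Fin n)) * ft σ) : N ⧸ Subgroup.center N)) hmul
  have hinj : Function.Injective φ := by
    rw [← MonoidHom.ker_eq_bot_iff]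
    refine (hsimple.eq_bot_or_eq_top_of_normal φ.ker inferInstance).resolve_right ?_
    intro htop
    have hcen : ∀ σ : alternatingGroup (Fin n), g σ * ft σ ∈ Subgroup.center N := by
      intro σ
      have : σ ∈ φ.ker := htop ▸ Subgroup.mem_top σ
      exact (QuotientGroup.eq_one_iff _).1 this
    have hanti : ∀ σ τ : alternatingGroup (Fin n),
        g ((σ * τ : alternatingGroup (Fin n)) : Equiv.Perm (Fin n)) = g τ * g σ := by
      intro σ τ
      have hc := Subgroup.mem_center_iff.1 (hcen σ) (g τ)
      have e : g σ * (ft σ * g τ * (ft σ)⁻¹) = (g σ * ft σ) * g τ * (ft σ)⁻¹ := by group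
      rw [hgA, e, ← hc]
      group
    let ψ : alternatingGroup (Fin n) →* N :=
      MonoidHom.mk' (fun σ => g ((σ⁻¹ : alternatingGroup (Fin n)) : Equiv.Perm (Fin n))) (by
        intro σ τ
        rw [mul_inv_rev, hanti])
    have hψ : Function.Injective ψ := by
      intro σ τ h
      have h' := hg.1 h
      exact inv_injective (Subtype.ext h')
    have hcr : Nat.card ψ.range = Nat.card (alternatingGroup (Fin n)) :=
      (Nat.card_congr (MonoidHom.ofInjective hψ).toEquiv).symm
    have hidx : ψ.range.index = 2 := by
      have h := ψ.range.card_mul_index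
      rw [hcr, hcard, ← hcA, mul_comm 2] at h
      exact Nat.eq_of_mul_eq_mul_left Nat.card_pos h
    have hle : commutator N ≤ ψ.range := by
      rw [commutator_def, Subgroup.commutator_le]
      intro a _ b _
      rw [commutatorElement_def]
      simp only [Subgroup.mul_mem_iff_of_index_two hidx, inv_mem_iff]
      tauto
    rw [hperf, top_le_iff] at hle
    rw [hle, Subgroup.index_top] at hidx
    omega
  obtain ⟨e⟩ := hquot
  have : Finite (N ⧸ Subgroup.center N) := Finite.of_equiv _ e.symm.toEquiv
  exact (Nat.bijective_iff_injective_and_card φ).2 ⟨hinj, (Nat.card_congr e.toEquiv).symm⟩
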